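/- Let K be a field, m ≥ 3 and n ≥ 2m integers, and k = ⌊(n+1)/(m+1)⌋. Let L_k = (I_{n,m} : x_m x_{2m+1} ⋯ x_{k(m+1)−1}) be the colon of I_{n,m} by the product ∏_{l=1}^{k} x_{l(m+1)−1}. Then depth(S/L_k) = n + 1 − ⌊(n+1)/(m+1)⌋ − ⌈(n+1)/(m+1)⌉. -/

import Mathlib

open MvPolynomial

/-- The generator `u_i = x_i x_{i+1} ⋯ x_{i+m-1}` of the path ideal, where the
variables of `K[x_1,…,x_n]` are 1-indexed via `x_t = X ⟨t-1⟩`. -/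
noncomputable def pathGen (K : Type) [Field K] (n m i : ℕ) : MvPolynomial (Fin n) K :=
  ∏ j ∈ Finset.univ.filter (fun j : Fin n => i ≤ (j : ℕ) + 1 ∧ (j : ℕ) + 1 < i + m),
    X j

/-- The monomial `u_i / x_p = ∏_{i ≤ l ≤ i+m-1, l ≠ p} x_l`. -/
noncomputable def pathGenDiv (K : Type) [Field K] (n m i p : ℕ) : MvPolynomial (Fin n) K :=
  ∏ j ∈ Finset.univ.filter
      (fun j : Fin n => (i ≤ (j : ℕ) + 1 ∧ (j : ℕ) + 1 < i + m) ∧ (j : ℕ) + 1 ≠ p),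
    X j

/-- The path ideal `I_{n,m} = (u_1, …, u_{n-m+1}) ⊆ K[x_1,…,x_n]` of the line graph. -/
noncomputable def pathIdeal (K : Type) [Field K] (n m : ℕ) : Ideal (MvPolynomial (Fin n) K) :=
  Ideal.span {q | ∃ i : ℕ, 1 ≤ i ∧ i ≤ n - m + 1 ∧ q = pathGen K n m i}

/-- The variable `x_t` of `K[x_1,…,x_n]` (1-indexed; junk value `0` out of range). -/
noncomputable def xv (K : Type) [Field K] (n t : ℕ) : MvPolynomial (Fin n) K :=
  if h : 1 ≤ t ∧ t ≤ n then X (⟨t - 1, by omega⟩ : Fin n) else 0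

/-- The set of lengths of `(S/I)`-regular sequences consisting of homogeneous
elements of the graded maximal ideal `(x_1,…,x_n)` of `S = K[x_1,…,x_n]`.
The depth of `S/I` is the greatest element of this set. -/
def homogRegSeqLengths (K : Type) [Field K] (n : ℕ)
    (I : Ideal (MvPolynomial (Fin n) K)) : Set ℕ :=
  {d | ∃ rs : List (MvPolynomial (Fin n) K), rs.length = d ∧
    (∀ f ∈ rs, (∃ e : ℕ, f.IsHomogeneous e) ∧
      f ∈ Ideal.span (Set.range (X : Fin n → MvPolynomial (Fin n) K))) ∧
    RingTheory.Sequence.IsRegular (MvPolynomial (Fin n) K ⧸ I) rs}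

/-- `rs` is a weakly regular sequence on `R ⧸ J`, phrased through ideal membership. -/
def Ideal.WeaklyRegularMod {R : Type*} [CommRing R] : Ideal R → List R → Prop
  | _, [] => True
  | J, r :: rs => (∀ f, r * f ∈ J → f ∈ J) ∧ Ideal.WeaklyRegularMod (J ⊔ Ideal.span {r}) rs

namespace Ideal

variable {R : Type*} [CommRing R]

lemma mem_sup_span_singleton_iff {J : Ideal R} {r f : R} :
    f ∈ J ⊔ span {r} ↔ ∃ j ∈ J, ∃ g, f = j + r * g := by
  rw [Submodule.mem_sup]
  constructor
  · rintro ⟨j, hj, y, hy, rfl⟩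
    obtain ⟨g, rfl⟩ := mem_span_singleton.1 hy
    exact ⟨j, hj, g, rfl⟩
  · rintro ⟨j, hj, g, rfl⟩
    exact ⟨j, hj, _, mem_span_singleton.2 ⟨g, rfl⟩, rfl⟩

lemma mem_sup_span_singleton_of_sub_mem {J : Ideal R} {r f g : R} (h : f - r * g ∈ J) :
    f ∈ J ⊔ span {r} :=
  mem_sup_span_singleton_iff.2 ⟨_, h, g, by ring⟩

/-- The `R`-module `(R ⧸ J) / r (R ⧸ J)` is `R ⧸ (J + (r))`. -/
noncomputable def quotSMulTopQuotientEquiv (J : Ideal R) (r : R) :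
    QuotSMulTop r (R ⧸ J) ≃ₗ[R] R ⧸ (J ⊔ span {r}) :=
  (Submodule.quotEquivOfEq _ _ (by
    ext x
    simp only [Submodule.mem_smul_pointwise_iff_exists, Submodule.mem_map, mem_span_singleton]
    constructor
    · rintro ⟨y, -, rfl⟩
      obtain ⟨g, rfl⟩ := Submodule.Quotient.mk_surjective J y
      exact ⟨r * g, ⟨g, rfl⟩, rfl⟩
    · rintro ⟨_, ⟨g, rfl⟩, rfl⟩
      exact ⟨J.mkQ g, trivial, rfl⟩)) ≪≫ₗ
  Submodule.quotientQuotientEquivQuotientSup J (span {r})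

lemma isWeaklyRegular_quotient_iff (J : Ideal R) (rs : List R) :
    RingTheory.Sequence.IsWeaklyRegular (R ⧸ J) rs ↔ J.WeaklyRegularMod rs := by
  induction rs generalizing J with
  | nil => simp [WeaklyRegularMod]
  | cons r rs ih =>
    rw [RingTheory.Sequence.isWeaklyRegular_cons_iff, WeaklyRegularMod,
      (quotSMulTopQuotientEquiv J r).isWeaklyRegular_congr, ih]
    refine and_congr_left fun _ ↦ ?_
    rw [isSMulRegular_iff_right_eq_zero_of_smul]
    constructor
    · intro h f hf
      have := h (Ideal.Quotient.mk J f) (by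
        rw [← Ideal.Quotient.eq_zero_iff_mem] at hf
        rw [← hf, Algebra.smul_def, map_mul]; rfl)
      exact Ideal.Quotient.eq_zero_iff_mem.1 this
    · intro h y hy
      obtain ⟨g, rfl⟩ := Ideal.Quotient.mk_surjective y
      rw [Ideal.Quotient.eq_zero_iff_mem]
      apply h
      rw [← Ideal.Quotient.eq_zero_iff_mem, ← hy, Algebra.smul_def, map_mul]; rfl

lemma weaklyRegularMod_top (rs : List R) : (⊤ : Ideal R).WeaklyRegularMod rs := by
  induction rs with
  | nil => trivial
  | cons r rs ih => exact ⟨fun _ _ ↦ trivial, by rwa [top_sup_eq]⟩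

/-- If `rs` is weakly regular modulo `(J : x)` and modulo `J + (x)`, it is so modulo `J`. -/
lemma WeaklyRegularMod.of_colon_of_sup {J J' : Ideal R} {x : R} {rs : List R}
    (hJ' : ∀ f, f ∈ J' ↔ x * f ∈ J) (h₁ : J'.WeaklyRegularMod rs)
    (h₂ : (J ⊔ span {x}).WeaklyRegularMod rs) : J.WeaklyRegularMod rs := by
  induction rs generalizing J J' with
  | nil => trivial
  | cons r rs ih =>
    obtain ⟨h₁r, h₁s⟩ := h₁
    obtain ⟨h₂r, h₂s⟩ := h₂
    constructor
    · intro f hf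
      obtain ⟨j, hj, g, rfl⟩ := mem_sup_span_singleton_iff.1
        (h₂r f ((le_sup_left : J ≤ J ⊔ span {x}) hf))
      refine J.add_mem hj ((hJ' _).1 (h₁r _ ((hJ' _).2 ?_)))
      have : r * (j + x * g) - r * j ∈ J := J.sub_mem hf (J.mul_mem_left _ hj)
      convert this using 1
      ring
    · refine ih (J' := J' ⊔ span {r}) (fun f ↦ ⟨fun hf ↦ ?_, fun hf ↦ ?_⟩) h₁s
        (by rwa [sup_right_comm])
      · obtain ⟨j, hj, g, rfl⟩ := mem_sup_span_singleton_iff.1 hf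
        exact mem_sup_span_singleton_iff.2 ⟨x * j, (hJ' _).1 hj, x * g, by ring⟩
      · obtain ⟨j, hj, g, hg⟩ := mem_sup_span_singleton_iff.1 hf
        have : g ∈ J ⊔ span {x} := h₂r g (mem_sup_span_singleton_iff.2
          ⟨-j, J.neg_mem hj, f, by linear_combination -hg⟩)
        obtain ⟨j', hj', g', rfl⟩ := mem_sup_span_singleton_iff.1 this
        refine mem_sup_span_singleton_of_sub_mem (g := g') ((hJ' _).2 ?_)
        have := J.add_mem hj (J.mul_mem_left r hj')
        convert this using 1
        linear_combination hg

end Ideal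

namespace MvPolynomial

attribute [local instance] MvPolynomial.gradedAlgebra

variable {σ K : Type*} [Field K]

lemma isHomogeneous_sup_span_singleton {J : Ideal (MvPolynomial σ K)}
    (hJ : J.IsHomogeneous (homogeneousSubmodule σ K)) {r : MvPolynomial σ K} {e : ℕ}
    (hr : r.IsHomogeneous e) :
    (J ⊔ Ideal.span {r}).IsHomogeneous (homogeneousSubmodule σ K) := by
  refine hJ.sup (Ideal.homogeneous_span _ _ ?_)
  rintro _ rfl
  exact ⟨e, hr⟩

/-- A homogeneous ideal is closed in the topology defined by powers of an element of the
irrelevant ideal. -/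
lemma mem_of_forall_mem_sup_span_pow {J : Ideal (MvPolynomial σ K)}
    (hJ : J.IsHomogeneous (homogeneousSubmodule σ K)) {x : MvPolynomial σ K}
    (hx : x ∈ idealOfVars σ K) {f : MvPolynomial σ K}
    (hf : ∀ N : ℕ, f ∈ J ⊔ Ideal.span {x ^ N}) : f ∈ J := by
  rw [mem_iff_homogeneousComponent_mem hJ]
  intro i
  obtain ⟨j, hj, g, rfl⟩ := Ideal.mem_sup_span_singleton_iff.1 (hf (i + 1))
  have hg : x ^ (i + 1) * g ∈ idealOfVars σ K ^ (i + 1) :=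
    Ideal.mul_mem_right _ _ (Ideal.pow_mem_pow hx _)
  rw [map_add]
  have h0 : homogeneousComponent i (x ^ (i + 1) * g) = 0 := by
    apply homogeneousComponent_eq_zero'
    intro d hd
    have := (mem_pow_idealOfVars_iff _ _).1 hg d hd
    omega
  rw [h0, add_zero]
  exact homogeneousComponent_mem_of_mem hJ hj i

lemma mem_of_forall_exists_mul {J : Ideal (MvPolynomial σ K)}
    (hJ : J.IsHomogeneous (homogeneousSubmodule σ K)) {x : MvPolynomial σ K}
    (hx : x ∈ idealOfVars σ K) {p : MvPolynomial σ K → Prop}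
    (hp : ∀ f, p f → ∃ g, p g ∧ f - x * g ∈ J) {f : MvPolynomial σ K} (hf : p f) : f ∈ J := by
  refine mem_of_forall_mem_sup_span_pow hJ hx fun N ↦ ?_
  induction N generalizing f with
  | zero => simp
  | succ N ih =>
    obtain ⟨g, hg, hfg⟩ := hp f hf
    obtain ⟨j, hj, h, rfl⟩ := Ideal.mem_sup_span_singleton_iff.1 (ih hg)
    refine Ideal.mem_sup_span_singleton_iff.2 ⟨f - x * (j + x ^ N * h) + x * j,
      J.add_mem hfg (J.mul_mem_left _ hj), h, by ring⟩

/-- A homogeneous sequence which is weakly regular modulo `J + (x)`, with `x` a homogeneous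
nonzerodivisor modulo the homogeneous ideal `J`, is weakly regular modulo `J`. -/
lemma weaklyRegularMod_of_sup_span {J : Ideal (MvPolynomial σ K)}
    (hJ : J.IsHomogeneous (homogeneousSubmodule σ K)) {x : MvPolynomial σ K}
    (hx : x ∈ idealOfVars σ K) (hreg : ∀ f, x * f ∈ J → f ∈ J)
    {rs : List (MvPolynomial σ K)} (hrs : ∀ r ∈ rs, ∃ e, r.IsHomogeneous e)
    (h : (J ⊔ Ideal.span {x}).WeaklyRegularMod rs) : J.WeaklyRegularMod rs := by
  induction rs generalizing J with
  | nil => trivial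
  | cons r rs ih =>
    obtain ⟨hr, hs⟩ := h
    obtain ⟨e, he⟩ := hrs r (by simp)
    refine ⟨fun f hf ↦ ?_, ih (isHomogeneous_sup_span_singleton hJ he) (fun f hf ↦ ?_)
      (fun s hs ↦ hrs s (by simp [hs])) (by rwa [sup_right_comm])⟩
    · refine mem_of_forall_exists_mul hJ hx (p := fun f ↦ r * f ∈ J) (fun f hf ↦ ?_) hf
      obtain ⟨j, hj, g, rfl⟩ := Ideal.mem_sup_span_singleton_iff.1
        (hr f ((le_sup_left : J ≤ J ⊔ Ideal.span {x}) hf))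
      refine ⟨g, hreg _ ?_, by simpa⟩
      have := J.sub_mem hf (J.mul_mem_left r hj)
      convert this using 1
      ring
    · obtain ⟨j, hj, g, hg⟩ := Ideal.mem_sup_span_singleton_iff.1 hf
      obtain ⟨j', hj', g', rfl⟩ := Ideal.mem_sup_span_singleton_iff.1 (hr g
        (Ideal.mem_sup_span_singleton_iff.2 ⟨-j, J.neg_mem hj, f, by linear_combination -hg⟩))
      refine Ideal.mem_sup_span_singleton_of_sub_mem (g := g') (hreg _ ?_)
      have := J.add_mem hj (J.mul_mem_left r hj')
      convert this using 1
      linear_combination hg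

/-- If `P` is an associated prime of a homogeneous ideal `J`, then regular sequences of
homogeneous elements modulo `J` have length at most the dimension of the quotient by `P`. -/
lemma length_le_ringKrullDim_of_weaklyRegularMod [Finite σ] {J P : Ideal (MvPolynomial σ K)}
    (hJ : J.IsHomogeneous (homogeneousSubmodule σ K)) [hP : P.IsPrime] {w : MvPolynomial σ K}
    (hw : ∀ f, f ∈ P ↔ f * w ∈ J)
    {rs : List (MvPolynomial σ K)}
    (hrs : ∀ r ∈ rs, (∃ e, r.IsHomogeneous e) ∧ r ∈ idealOfVars σ K)
    (h : J.WeaklyRegularMod rs) :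
    (rs.length : WithBot ℕ∞) ≤ ringKrullDim (MvPolynomial σ K ⧸ P) := by
  induction rs generalizing J P w with
  | nil => simpa using ringKrullDim_nonneg_of_nontrivial
  | cons r rs ih =>
    obtain ⟨hr, hs⟩ := h
    obtain ⟨⟨e, he⟩, hrm⟩ := hrs r (by simp)
    have hwJ : w ∉ J := fun hc ↦ hP.ne_top ((Ideal.eq_top_iff_one _).2 ((hw 1).2 (by simpa)))
    have hrP : r ∉ P := fun hc ↦ hwJ (hr _ ((hw r).1 hc))
    obtain ⟨f, hfP, hfJ⟩ : ∃ f, (∀ p ∈ P, p * f ∈ J) ∧ f ∉ J ⊔ Ideal.span {r} := by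
      by_contra! hc
      refine hwJ (mem_of_forall_exists_mul hJ hrm (p := fun f ↦ ∀ p ∈ P, p * f ∈ J)
        (fun f hf ↦ ?_) fun p hp ↦ (hw p).1 hp)
      obtain ⟨j, hj, g, rfl⟩ := Ideal.mem_sup_span_singleton_iff.1 (hc f hf)
      refine ⟨g, fun p hp ↦ hr _ ?_, by simpa⟩
      have := J.sub_mem (hf p hp) (J.mul_mem_left p hj)
      convert this using 1
      ring
    set J' := J ⊔ Ideal.span {r} with hJ'
    obtain ⟨Q, hQ, hle⟩ := exists_le_isAssociatedPrime_of_isNoetherianRing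
      (MvPolynomial σ K) (M := MvPolynomial σ K ⧸ J') (Ideal.Quotient.mk J' f)
      (by rwa [ne_eq, Ideal.Quotient.eq_zero_iff_mem])
    obtain ⟨hQp, y, hy⟩ := isAssociatedPrime_iff.1 hQ
    obtain ⟨v, rfl⟩ := Ideal.Quotient.mk_surjective y
    have mem_iff : ∀ u q, q ∈ (⊥ : Submodule (MvPolynomial σ K) (MvPolynomial σ K ⧸ J')).colon
        {Ideal.Quotient.mk J' u} ↔ q * u ∈ J' := by
      intro u q
      rw [Submodule.mem_colon_singleton, Submodule.mem_bot, ← Ideal.Quotient.eq_zero_iff_mem,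
        map_mul, Algebra.smul_def]
      rfl
    have hPQ : P ≤ Q := fun p hp ↦ hle ((mem_iff _ _).2
      ((le_sup_left : J ≤ J') (hfP p hp)))
    have hrQ : r ∈ Q := hle ((mem_iff _ _).2
      (Ideal.mul_mem_right _ _ ((le_sup_right : _ ≤ J') (Ideal.mem_span_singleton_self r))))
    have key := ih (isHomogeneous_sup_span_singleton hJ he) (P := Q) (w := v)
      (fun q ↦ by rw [hy]; exact mem_iff v q) (fun s hs ↦ hrs s (by simp [hs])) hs
    have hdim : ringKrullDim (MvPolynomial σ K ⧸ Q) + 1 ≤ ringKrullDim (MvPolynomial σ K ⧸ P) :=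
      ringKrullDim_succ_le_of_surjective (Ideal.Quotient.factor hPQ)
        (Ideal.Quotient.factor_surjective hPQ) (r := Ideal.Quotient.mk P r)
        (mem_nonZeroDivisors_of_ne_zero (by rwa [ne_eq, Ideal.Quotient.eq_zero_iff_mem]))
        (by rw [Ideal.Quotient.factor_mk, Ideal.Quotient.eq_zero_iff_mem]; exact hrQ)
    refine le_trans ?_ hdim
    push_cast [List.length_cons]
    gcongr

end MvPolynomial

/-- The squarefree monomial ideal spanned by the monomials whose support satisfies `φ`. -/
noncomputable def supportIdeal {σ : Type*} (K : Type*) [Field K] (φ : Finset σ → Prop) :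
    Ideal (MvPolynomial σ K) :=
  Ideal.span ((fun s : σ →₀ ℕ ↦ monomial s (1 : K)) '' {s | φ s.support})

section SupportIdeal

attribute [local instance] MvPolynomial.gradedAlgebra

variable {σ K : Type*} [Field K] {φ : Finset σ → Prop}

lemma mem_supportIdeal_iff (hφ : Monotone φ) {f : MvPolynomial σ K} :
    f ∈ supportIdeal K φ ↔ ∀ m ∈ f.support, φ m.support := by
  rw [supportIdeal, mem_ideal_span_monomial_image]
  refine forall₂_congr fun m _ ↦ ⟨?_, fun h ↦ ⟨m, h, le_rfl⟩⟩
  rintro ⟨s, hs, hsm⟩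
  exact hφ (Finsupp.support_mono hsm) hs

lemma isHomogeneous_supportIdeal :
    (supportIdeal K φ).IsHomogeneous (homogeneousSubmodule σ K) := by
  refine Ideal.homogeneous_span _ _ ?_
  rintro _ ⟨s, -, rfl⟩
  exact ⟨s.degree, isHomogeneous_monomial _ rfl⟩

lemma supportIdeal_eq_top (h : φ ∅) : supportIdeal K φ = ⊤ :=
  (Ideal.eq_top_iff_one _).2 (Ideal.subset_span ⟨0, by simpa using h, rfl⟩)

lemma supportIdeal_sup_span_X (x : σ) :
    supportIdeal K φ ⊔ Ideal.span {X x} = supportIdeal K (fun F ↦ φ F ∨ x ∈ F) := by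
  refine le_antisymm (sup_le (Ideal.span_mono (Set.image_mono fun s hs ↦ Or.inl hs)) ?_)
    (Ideal.span_le.2 ?_)
  · rw [Ideal.span_singleton_le_iff_mem]
    exact Ideal.subset_span ⟨Finsupp.single x 1, Or.inr (by simp), rfl⟩
  · rintro _ ⟨s, hs | hs, rfl⟩
    · exact (le_sup_left : supportIdeal K φ ≤ _) (Ideal.subset_span ⟨s, hs, rfl⟩)
    · refine (le_sup_right : Ideal.span {X x} ≤ _) (Ideal.mem_span_singleton.2 ?_)
      rw [X_dvd_monomial]
      exact Or.inr (Finsupp.mem_support_iff.1 hs)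

variable (K) in
/-- The prime ideal generated by the variables in `W`. -/
noncomputable abbrev varIdeal (W : Finset σ) : Ideal (MvPolynomial σ K) :=
  supportIdeal K (fun F ↦ ∃ x ∈ W, x ∈ F)

lemma monotone_exists_mem (W : Finset σ) : Monotone (fun F : Finset σ ↦ ∃ x ∈ W, x ∈ F) :=
  fun _ _ h ⟨x, hx, hxF⟩ ↦ ⟨x, hx, h hxF⟩

lemma X_mem_varIdeal {W : Finset σ} {x : σ} (hx : x ∈ W) :
    (X x : MvPolynomial σ K) ∈ varIdeal K W :=
  Ideal.subset_span ⟨Finsupp.single x 1, ⟨x, hx, by simp⟩, rfl⟩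

lemma supportIdeal_le_idealOfVars (h : ¬ φ ∅) : supportIdeal K φ ≤ idealOfVars σ K := by
  refine Ideal.span_le.2 ?_
  rintro _ ⟨s, hs, rfl⟩
  obtain ⟨x, hx⟩ : s.support.Nonempty :=
    Finset.nonempty_iff_ne_empty.2 fun hc ↦ h (by rwa [Set.mem_ofPred_eq, hc] at hs)
  exact Ideal.mem_of_dvd _ (X_dvd_monomial.2 (Or.inr (Finsupp.mem_support_iff.1 hx)))
    (Ideal.subset_span (Set.mem_range_self x))

lemma prod_X_dvd_monomial {T : Finset σ} {s : σ →₀ ℕ} (h : T ⊆ s.support) :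
    (∏ x ∈ T, X x : MvPolynomial σ K) ∣ monomial s 1 := by
  classical
  have hprod : (∏ x ∈ T, X x : MvPolynomial σ K) = monomial (∑ x ∈ T, Finsupp.single x 1) 1 := by
    rw [monomial_sum_one]
    rfl
  rw [hprod, monomial_dvd_monomial]
  refine ⟨Or.inr fun x ↦ ?_, one_dvd _⟩
  rw [Finsupp.finsetSum_apply]
  simp only [Finsupp.single_apply, Finset.sum_ite_eq']
  split_ifs with hx
  · exact Nat.one_le_iff_ne_zero.2 (Finsupp.mem_support_iff.1 (h hx))
  · exact Nat.zero_le _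

variable [DecidableEq σ]

lemma monotone_comp_insert (hφ : Monotone φ) (x : σ) : Monotone fun F ↦ φ (insert x F) :=
  fun _ _ h ↦ hφ (Finset.insert_subset_insert x h)

lemma X_mul_mem_supportIdeal_iff (hφ : Monotone φ) (x : σ) (f : MvPolynomial σ K) :
    X x * f ∈ supportIdeal K φ ↔ f ∈ supportIdeal K (fun F ↦ φ (insert x F)) := by
  rw [mem_supportIdeal_iff hφ, mem_supportIdeal_iff (monotone_comp_insert hφ x), support_X_mul]
  simp only [Finset.mem_map, forall_exists_index, and_imp, forall_apply_eq_imp_iff₂]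
  refine forall₂_congr fun m _ ↦ ?_
  have : (Finsupp.single x 1 + m).support = insert x m.support := by
    ext y
    by_cases h : x = y <;> simp [h, eq_comm]
  simp [this]

lemma prod_X_mul_mem_supportIdeal_iff (hφ : Monotone φ) (T : Finset σ) (f : MvPolynomial σ K) :
    (∏ x ∈ T, X x) * f ∈ supportIdeal K φ ↔ f ∈ supportIdeal K (fun F ↦ φ (T ∪ F)) := by
  induction T using Finset.induction_on generalizing φ with
  | empty => simp
  | insert x T hx ih =>
    rw [Finset.prod_insert hx, mul_assoc, X_mul_mem_supportIdeal_iff hφ,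
      ih (monotone_comp_insert hφ x)]
    simp [Finset.insert_union]

lemma prod_X_mem_supportIdeal (hφ : Monotone φ) {T : Finset σ} (hT : φ T) :
    (∏ x ∈ T, X x : MvPolynomial σ K) ∈ supportIdeal K φ := by
  rw [← mul_one (∏ x ∈ T, X x), prod_X_mul_mem_supportIdeal_iff hφ,
    supportIdeal_eq_top (by rwa [Finset.union_empty])]
  trivial

/-- The `K`-algebra map to the polynomial ring on the variables outside `W` which kills `W`. -/
noncomputable def killVars (K : Type*) [Field K] (W : Finset σ) :
    MvPolynomial σ K →ₐ[K] MvPolynomial {x // x ∉ W} K :=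
  aeval fun x ↦ if h : x ∉ W then X ⟨x, h⟩ else 0

lemma sub_rename_killVars_mem (W : Finset σ) (f : MvPolynomial σ K) :
    f - rename Subtype.val (killVars K W f) ∈ varIdeal K W := by
  induction f using MvPolynomial.induction_on with
  | C a => simp [killVars, algebraMap_eq]
  | add p q hp hq =>
    have := Ideal.add_mem _ hp hq
    convert this using 1
    simp only [map_add]
    ring
  | mul_X p x hp =>
    have h1 := Ideal.mul_mem_right (X x) _ hp
    by_cases hx : x ∈ W
    · simpa [killVars, hx] using Ideal.mul_mem_left (varIdeal K W) p (X_mem_varIdeal hx)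
    · convert h1 using 1
      simp [killVars, hx, sub_mul]

lemma mem_varIdeal_iff_killVars {W : Finset σ} {f : MvPolynomial σ K} :
    f ∈ varIdeal K W ↔ killVars K W f = 0 := by
  constructor
  · intro hf
    have : varIdeal K W ≤ RingHom.ker (killVars K W) := by
      refine Ideal.span_le.2 ?_
      rintro _ ⟨s, ⟨x, hxW, hxs⟩, rfl⟩
      have : (X x : MvPolynomial σ K) ∣ monomial s 1 :=
        X_dvd_monomial.2 (Or.inr (Finsupp.mem_support_iff.1 hxs))
      refine Ideal.mem_of_dvd _ this ?_
      simp [killVars, hxW]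
    exact this hf
  · intro hf
    simpa [hf] using sub_rename_killVars_mem W f

instance varIdeal_isPrime (W : Finset σ) : (varIdeal K W).IsPrime := by
  have : varIdeal K W = RingHom.ker (killVars K W) := by
    ext f
    exact mem_varIdeal_iff_killVars
  rw [this]
  exact RingHom.ker_isPrime _

lemma prod_X_mem_varIdeal_iff {W T : Finset σ} :
    (∏ x ∈ T, X x : MvPolynomial σ K) ∈ varIdeal K W ↔ ¬ Disjoint T W := by
  rw [(varIdeal_isPrime W).prod_mem_iff, Finset.not_disjoint_iff]
  refine exists_congr fun x ↦ and_congr_right fun _ ↦ ⟨fun h ↦ ?_, X_mem_varIdeal⟩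
  rw [mem_supportIdeal_iff (monotone_exists_mem W)] at h
  obtain ⟨y, hy, hyx⟩ := h (Finsupp.single x 1) (by simp [X])
  have : x = y := by
    by_contra hne
    simp [Ne.symm hne] at hyx
  rwa [this]

lemma ringKrullDim_quotient_varIdeal_le [Finite σ] (W : Finset σ) :
    ringKrullDim (MvPolynomial σ K ⧸ varIdeal K W) ≤ Nat.card {x // x ∉ W} := by
  have h : ringKrullDim (MvPolynomial {x // x ∉ W} K) = Nat.card {x // x ∉ W} := by
    rw [MvPolynomial.ringKrullDim_of_isNoetherianRing, ringKrullDim_eq_zero_of_field, zero_add]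
  rw [← h]
  refine ringKrullDim_le_of_surjective
    ((Ideal.Quotient.mk (varIdeal K W)).comp (rename Subtype.val).toRingHom) fun y ↦ ?_
  obtain ⟨f, rfl⟩ := Ideal.Quotient.mk_surjective y
  exact ⟨killVars K W f, (Ideal.Quotient.eq.2 (sub_rename_killVars_mem W f)).symm⟩

/-- If `Wᶜ` is a facet of the complex of non-members of `φ`, then homogeneous regular sequences
modulo the ideal of `φ` have length at most `#Wᶜ`. -/
lemma length_le_card_compl_of_weaklyRegularMod [Fintype σ] (hφ : Monotone φ) (W : Finset σ)
    (hW : ¬ φ Wᶜ) (hW' : ∀ x ∈ W, φ (insert x Wᶜ)) {rs : List (MvPolynomial σ K)}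
    (hrs : ∀ r ∈ rs, (∃ e, r.IsHomogeneous e) ∧ r ∈ idealOfVars σ K)
    (h : (supportIdeal K φ).WeaklyRegularMod rs) : rs.length + W.card ≤ Fintype.card σ := by
  have hle : (rs.length : WithBot ℕ∞) ≤ (Nat.card {x // x ∉ W} : ℕ) := by
    refine le_trans (length_le_ringKrullDim_of_weaklyRegularMod (P := varIdeal K W)
      (w := ∏ x ∈ Wᶜ, X x) isHomogeneous_supportIdeal (fun f ↦ ?_) hrs h)
      (ringKrullDim_quotient_varIdeal_le W)
    have : (fun F ↦ φ (Wᶜ ∪ F)) = fun F ↦ ∃ x ∈ W, x ∈ F := by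
      funext F
      refine propext ⟨fun hF ↦ ?_, fun ⟨x, hx, hxF⟩ ↦ hφ ?_ (hW' x hx)⟩
      · by_contra! hc
        have hF' : F ⊆ Wᶜ := fun x hx ↦ Finset.mem_compl.2 fun hxW ↦ hc x hxW hx
        exact hW (by rwa [Finset.union_eq_left.2 hF'] at hF)
      · exact Finset.insert_subset (Finset.mem_union_right _ hxF) Finset.subset_union_left
    rw [mul_comm, prod_X_mul_mem_supportIdeal_iff hφ, this]
  have hcard : Nat.card {x // x ∉ W} = Fintype.card σ - W.card := by
    rw [Nat.card_eq_fintype_card, Fintype.card_subtype_compl]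
    simp
  have : rs.length ≤ Fintype.card σ - W.card := by
    rw [hcard] at hle
    exact_mod_cast hle
  have := W.card_le_univ
  omega

end SupportIdeal

/-- Monotone families of finsets that can be reduced to families `{F | F ∩ W ≠ ∅}` with
`#W ≤ c`, and the family of all finsets, by splitting along vertices. -/
inductive SplitsBelow {σ : Type*} [DecidableEq σ] (c : ℕ) : (Finset σ → Prop) → Prop
  | top : SplitsBelow c fun _ ↦ True
  | vars (W : Finset σ) (hW : W.card ≤ c) : SplitsBelow c fun F ↦ ∃ x ∈ W, x ∈ F
  | split (φ : Finset σ → Prop) (x : σ) (hφ : Monotone φ)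
      (h₁ : SplitsBelow c fun F ↦ φ (insert x F)) (h₂ : SplitsBelow c fun F ↦ φ F ∨ x ∈ F) :
      SplitsBelow c φ

namespace SplitsBelow

variable {σ : Type*} [DecidableEq σ] {c c' : ℕ} {φ ψ : Finset σ → Prop}

lemma congr (h : SplitsBelow c φ) (he : ∀ F, φ F ↔ ψ F) : SplitsBelow c ψ := by
  rwa [show ψ = φ from funext fun F ↦ propext (he F).symm]

lemma of_forall (h : ∀ F, φ F) : SplitsBelow c φ := top.congr fun F ↦ by simp [h F]

lemma mono (h : SplitsBelow c φ) (hc : c ≤ c') : SplitsBelow c' φ := by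
  induction h with
  | top => exact top
  | vars W hW => exact vars W (hW.trans hc)
  | split φ x hφ _ _ ih₁ ih₂ => exact split φ x hφ ih₁ ih₂

lemma monotone (h : SplitsBelow c φ) : Monotone φ := by
  induction h with
  | top => exact fun _ _ _ _ ↦ trivial
  | vars W hW => exact monotone_exists_mem W
  | split φ x hφ _ _ _ _ => exact hφ

lemma insert (h : SplitsBelow c φ) (x : σ) : SplitsBelow c fun F ↦ φ (insert x F) := by
  induction h with
  | top => exact top
  | vars W hW =>
    by_cases hx : x ∈ W
    · exact of_forall fun F ↦ ⟨x, hx, by simp⟩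
    · exact (vars W hW).congr fun F ↦ exists_congr fun y ↦ and_congr_right fun hy ↦ by
        simp [show y ≠ x from fun h ↦ hx (h ▸ hy)]
  | split φ y hφ h₁ h₂ ih₁ ih₂ =>
    by_cases hxy : x = y
    · subst hxy
      exact h₁
    · refine split _ y (monotone_comp_insert hφ x) (ih₁.congr fun F ↦ ?_) (ih₂.congr fun F ↦ ?_)
      · rw [Finset.insert_comm]
      · simp [Ne.symm hxy]

lemma or_mem (h : SplitsBelow c φ) (x : σ) : SplitsBelow (c + 1) fun F ↦ φ F ∨ x ∈ F := by
  induction h with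
  | top => exact of_forall fun _ ↦ Or.inl trivial
  | vars W hW =>
    refine (vars (Insert.insert x W) ((Finset.card_insert_le _ _).trans (by omega))).congr
      fun F ↦ ?_
    simp [or_comm]
  | split φ y hφ h₁ h₂ ih₁ ih₂ =>
    have hm : Monotone fun F ↦ φ F ∨ x ∈ F := fun _ _ h ↦ Or.imp (hφ h) (@h x)
    by_cases hxy : x = y
    · subst hxy
      exact h₂.mono (by omega)
    · refine split _ y hm (ih₁.congr fun F ↦ ?_) (ih₂.congr fun F ↦ ?_)
      · simp [hxy]
      · tauto

lemma or_subset (h : SplitsBelow c φ) (Q : Finset σ) :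
    SplitsBelow (c + 1) fun F ↦ φ F ∨ Q ⊆ F := by
  induction Q using Finset.induction_on generalizing φ with
  | empty => exact of_forall fun F ↦ Or.inr (Finset.empty_subset F)
  | insert q Q hq ih =>
    refine split _ q (fun _ _ hFG ↦ Or.imp (h.monotone hFG) fun hQ ↦ hQ.trans hFG)
      ((ih (h.insert q)).congr fun F ↦ or_congr_right ?_) ((h.or_mem q).congr fun F ↦ ?_)
    · simp [Finset.insert_subset_iff, Finset.subset_insert_iff_of_notMem hq]
    · simp only [Finset.insert_subset_iff]
      tauto

lemma weaklyRegularMod_of_varIdeal {K : Type*} [Field K]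
    (h : SplitsBelow c φ) {rs : List (MvPolynomial σ K)}
    (hrs : ∀ W : Finset σ, W.card ≤ c → (varIdeal K W).WeaklyRegularMod rs) :
    (supportIdeal K φ).WeaklyRegularMod rs := by
  induction h with
  | top =>
    rw [supportIdeal_eq_top trivial]
    exact Ideal.weaklyRegularMod_top rs
  | vars W hW => exact hrs W hW
  | split φ x hφ _ _ ih₁ ih₂ =>
    refine Ideal.WeaklyRegularMod.of_colon_of_sup (x := X x)
      (fun f ↦ (X_mul_mem_supportIdeal_iff hφ x f).symm) ih₁ ?_
    rwa [supportIdeal_sup_span_X]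

end SplitsBelow

section Esymm

attribute [local instance] MvPolynomial.gradedAlgebra

/-- The elementary symmetric polynomials `e_d, e_{d-1}, …, e_1`. -/
noncomputable def esymmList (σ K : Type*) [Fintype σ] [Field K] : ℕ → List (MvPolynomial σ K)
  | 0 => []
  | d + 1 => esymm σ K (d + 1) :: esymmList σ K d

variable {σ K : Type*} [Fintype σ] [Field K]

lemma isHomogeneous_esymm (d : ℕ) : (esymm σ K d).IsHomogeneous d := by
  refine IsHomogeneous.sum _ _ _ fun t ht ↦ ?_
  have := IsHomogeneous.prod t (fun i ↦ (X i : MvPolynomial σ K)) (fun _ ↦ 1)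
    fun i _ ↦ isHomogeneous_X _ _
  simpa [(Finset.mem_powersetCard.1 ht).2] using this

lemma length_esymmList (d : ℕ) : (esymmList σ K d).length = d := by
  induction d with
  | zero => rfl
  | succ d ih => simp [esymmList, ih]

lemma esymmList_homogeneous {d : ℕ} : ∀ r ∈ esymmList σ K d,
    (∃ e, r.IsHomogeneous e) ∧ r ∈ idealOfVars σ K := by
  induction d with
  | zero => simp [esymmList]
  | succ d ih =>
    intro r hr
    rcases List.mem_cons.1 hr with rfl | hr
    · refine ⟨⟨_, isHomogeneous_esymm _⟩, Ideal.sum_mem _ fun t ht ↦ ?_⟩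
      obtain ⟨x, hx⟩ : t.Nonempty := Finset.card_pos.1 (by
        rw [(Finset.mem_powersetCard.1 ht).2]; omega)
      exact Ideal.mem_of_dvd _ (Finset.dvd_prod_of_mem _ hx)
        (Ideal.subset_span (Set.mem_range_self x))
    · exact ih r hr

variable [DecidableEq σ]

lemma esymm_notMem_varIdeal {W : Finset σ} {d : ℕ} (h : W.card + d ≤ Fintype.card σ) :
    esymm σ K d ∉ varIdeal K W := by
  obtain ⟨T, hT, hTd⟩ := Finset.exists_subset_card_eq (s := Wᶜ) (n := d) (by
    rw [Finset.card_compl]; omega)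
  intro hc
  have := (mem_supportIdeal_iff (monotone_exists_mem W)).1 hc (∑ i ∈ T, Finsupp.single i 1)
    (by
      rw [support_esymm']
      simp only [Finset.mem_biUnion, Finset.mem_powersetCard]
      exact ⟨T, ⟨Finset.subset_univ _, hTd⟩, by simp⟩)
  obtain ⟨x, hxW, hx⟩ := this
  rw [Finsupp.mem_support_iff, Finsupp.finsetSum_apply] at hx
  obtain ⟨y, hy, hyx⟩ := Finset.exists_ne_zero_of_sum_ne_zero hx
  have : y = x := by
    by_contra hne
    simp [hne] at hyx
  exact Finset.mem_compl.1 (hT hy) (this ▸ hxW)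

lemma varIdeal_sup_span_esymm {W : Finset σ} {d : ℕ} (h : W.card + d = Fintype.card σ) :
    varIdeal K W ⊔ Ideal.span {esymm σ K d} =
      supportIdeal K (fun F ↦ (∃ x ∈ W, x ∈ F) ∨ Wᶜ ⊆ F) := by
  have hcard : Wᶜ.card = d := by rw [Finset.card_compl]; omega
  have hsub : esymm σ K d - ∏ x ∈ Wᶜ, X x ∈ varIdeal K W := by
    rw [esymm, ← Finset.sum_erase_add _ _ (Finset.mem_powersetCard.2
      ⟨Finset.subset_univ Wᶜ, hcard⟩), add_sub_cancel_right]
    refine Ideal.sum_mem _ fun T hT ↦ prod_X_mem_varIdeal_iff.2 fun hd ↦ ?_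
    rw [Finset.mem_erase, Finset.mem_powersetCard] at hT
    refine hT.1 (Finset.eq_of_subset_of_card_le (fun x hx ↦ ?_) (by rw [hcard, hT.2.2]))
    exact Finset.mem_compl.2 (Finset.disjoint_left.1 hd hx)
  have hm : Monotone fun F ↦ (∃ x ∈ W, x ∈ F) ∨ Wᶜ ⊆ F :=
    fun _ _ h ↦ Or.imp (@monotone_exists_mem _ W _ _ h) fun hF ↦ hF.trans h
  refine le_antisymm (sup_le (Ideal.span_mono (Set.image_mono fun s hs ↦ Or.inl hs)) ?_)
    (Ideal.span_le.2 ?_)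
  · rw [Ideal.span_singleton_le_iff_mem]
    have h1 : esymm σ K d - ∏ x ∈ Wᶜ, X x ∈
        supportIdeal K (fun F ↦ (∃ x ∈ W, x ∈ F) ∨ Wᶜ ⊆ F) :=
      Ideal.span_mono (Set.image_mono fun s hs ↦ Or.inl hs) hsub
    exact (Submodule.sub_mem_iff_left _ (prod_X_mem_supportIdeal hm (Or.inr subset_rfl))).1 h1
  · rintro _ ⟨s, hs | hs, rfl⟩
    · exact (le_sup_left : varIdeal K W ≤ _) (Ideal.subset_span ⟨s, hs, rfl⟩)
    · refine Ideal.mem_of_dvd _ (prod_X_dvd_monomial hs) ?_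
      refine (Submodule.sub_mem_iff_right _ ?_).1 ((le_sup_left : varIdeal K W ≤ _) hsub)
      exact (le_sup_right : Ideal.span {_} ≤ _) (Ideal.mem_span_singleton_self _)

lemma weaklyRegularMod_varIdeal_esymmList {d : ℕ} {W : Finset σ}
    (h : W.card + d ≤ Fintype.card σ) : (varIdeal K W).WeaklyRegularMod (esymmList σ K d) := by
  induction d generalizing W with
  | zero => trivial
  | succ d ih =>
    obtain ⟨t, ht⟩ := Nat.exists_eq_add_of_le h
    induction t generalizing W with
    | zero =>
      refine ⟨fun f hf ↦ ((varIdeal_isPrime W).mem_or_mem hf).resolve_left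
        (esymm_notMem_varIdeal h), ?_⟩
      rw [varIdeal_sup_span_esymm (by omega)]
      exact ((SplitsBelow.vars W le_rfl).or_subset Wᶜ).weaklyRegularMod_of_varIdeal
        fun W' hW' ↦ ih (by omega)
    | succ t iht =>
      obtain ⟨x, hx⟩ : Wᶜ.Nonempty := Finset.card_pos.1 (by rw [Finset.card_compl]; omega)
      rw [Finset.mem_compl] at hx
      have hsup : varIdeal K W ⊔ Ideal.span {X x} = varIdeal K (insert x W) := by
        rw [varIdeal, supportIdeal_sup_span_X, varIdeal]
        congr 1
        funext F
        simp [or_comm]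
      refine weaklyRegularMod_of_sup_span isHomogeneous_supportIdeal (x := X x)
        (Ideal.subset_span (Set.mem_range_self x)) (fun f hf ↦ ?_)
        (fun r hr ↦ (esymmList_homogeneous r hr).1) ?_
      · refine ((varIdeal_isPrime W).mem_or_mem hf).resolve_left fun hc ↦ ?_
        have := (prod_X_mem_varIdeal_iff (K := K) (W := W) (T := {x})).1 (by simpa using hc)
        simp [hx] at this
      · rw [hsup]
        exact iht (by rw [Finset.card_insert_of_notMem hx]; omega)
          (by rw [Finset.card_insert_of_notMem hx]; omega)

lemma SplitsBelow.weaklyRegularMod_esymmList {c d : ℕ} {φ : Finset σ → Prop}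
    (h : SplitsBelow c φ) (hcd : c + d ≤ Fintype.card σ) :
    (supportIdeal K φ).WeaklyRegularMod (esymmList σ K d) :=
  h.weaklyRegularMod_of_varIdeal fun _ hW ↦ weaklyRegularMod_varIdeal_esymmList (by omega)

end Esymm

lemma Nat.add_le_of_dvd_of_dvd_of_lt {d a b : ℕ} (ha : d ∣ a) (hb : d ∣ b) (h : a < b) :
    a + d ≤ b := by
  have := Nat.le_of_dvd (by omega) (Nat.dvd_sub hb ha)
  omega

lemma Nat.mul_add_mod_of_lt_left (a b : ℕ) {c : ℕ} (h : c < a) : (a * b + c) % a = c := by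
  rw [Nat.mul_add_mod, Nat.mod_eq_of_lt h]

section Window

/-- `G` holds on some interval of length `m` contained in `[0, e)`. -/
def HasWindow (m e : ℕ) (G : ℕ → Prop) : Prop :=
  ∃ s, s + m ≤ e ∧ ∀ i, s ≤ i → i < s + m → G i

lemma HasWindow.mono {m e e' : ℕ} {G G' : ℕ → Prop} (h : HasWindow m e G) (he : e ≤ e')
    (hG : ∀ i, G i → G' i) : HasWindow m e' G' :=
  let ⟨s, hs, hi⟩ := h
  ⟨s, hs.trans he, fun i h₁ h₂ ↦ hG i (hi i h₁ h₂)⟩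

/-- `F`, together with the positions `i ≡ -2 mod m + 1` and the interval `[p, p + t)`, contains
an interval of length `m` in `[0, e)`. -/
def CompletesWindow (n m e p t : ℕ) (F : Finset (Fin n)) : Prop :=
  HasWindow m e fun i ↦ m + 1 ∣ i + 2 ∨ (p ≤ i ∧ i < p + t) ∨ ∃ j ∈ F, (j : ℕ) = i

variable {n m e p t : ℕ}

lemma monotone_completesWindow : Monotone (CompletesWindow n m e p t) := fun _ _ hFG h ↦
  h.mono le_rfl fun _ ↦ Or.imp_right <| Or.imp_right fun ⟨j, hj, hji⟩ ↦ ⟨j, hFG hj, hji⟩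

lemma completesWindow_insert (hx : p + t < n) (F : Finset (Fin n)) :
    CompletesWindow n m e p t (insert ⟨p + t, hx⟩ F) ↔ CompletesWindow n m e p (t + 1) F := by
  unfold CompletesWindow
  have h : ∀ i, (∃ j ∈ insert (⟨p + t, hx⟩ : Fin n) F, (j : ℕ) = i) ↔
      p + t = i ∨ ∃ j ∈ F, (j : ℕ) = i := fun i ↦ by simp
  constructor <;> refine fun H ↦ H.mono le_rfl fun i ↦ ?_ <;> rw [h]
  · rintro (h | h | h | h)
    · exact Or.inl h
    · exact Or.inr (Or.inl (by omega))
    · exact Or.inr (Or.inl (by omega))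
    · exact Or.inr (Or.inr h)
  · rintro (h | h | h)
    · exact Or.inl h
    · by_cases h' : p + t = i
      · exact Or.inr (Or.inr (Or.inl h'))
      · exact Or.inr (Or.inl (by omega))
    · exact Or.inr (Or.inr (Or.inr h))

/-- A window ending beyond `p + t` must use the position `p + t`. -/
lemma completesWindow_or_mem (hp : m + 1 ∣ p + 1) (hx : p + t < n)
    (hpe : p + t < e) (he : e ≤ p + m) (F : Finset (Fin n)) :
    CompletesWindow n m e p t F ∨ (⟨p + t, hx⟩ : Fin n) ∈ F ↔
      CompletesWindow n m (p + t) p t F ∨ (⟨p + t, hx⟩ : Fin n) ∈ F := by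
  refine ⟨?_, Or.imp_left fun h ↦ h.mono hpe.le fun _ ↦ id⟩
  rintro (⟨s, hs, hi⟩ | h)
  · by_cases hsp : s + m ≤ p + t
    · exact Or.inl ⟨s, hsp, hi⟩
    · refine Or.inr ?_
      rcases hi (p + t) (by omega) (by omega) with h | h | ⟨j, hj, hjp⟩
      · have := Nat.add_le_of_dvd_of_dvd_of_lt hp h (by omega)
        omega
      · omega
      · exact (Fin.ext hjp : j = ⟨p + t, hx⟩) ▸ hj
  · exact Or.inr h

lemma completesWindow_of_le (hp : m + 1 ∣ p + 1) (hp0 : 1 ≤ p) (ht : m ≤ t + 1)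
    (F : Finset (Fin n)) : CompletesWindow n m (p + t) p t F := by
  refine ⟨p - 1, by omega, fun i h₁ h₂ ↦ ?_⟩
  by_cases hi : p ≤ i
  · exact Or.inr (Or.inl (by omega))
  · exact Or.inl (by rwa [show i + 2 = p + 1 by omega])

lemma completesWindow_iff (hp : m + 1 ∣ p + 1) (hmp : m ≤ p) (ht : t + 1 < m)
    (hpn : p ≤ n) (F : Finset (Fin n)) :
    CompletesWindow n m (p + t) p t F ↔ CompletesWindow n m (p - 1) 0 0 F ∨
      Finset.univ.filter (fun j : Fin n ↦ p + t ≤ j + m ∧ (j : ℕ) + 1 < p) ⊆ F := by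
  constructor
  · rintro ⟨s, hs, hi⟩
    by_cases hsp : s + m ≤ p - 1
    · refine Or.inl ⟨s, hsp, fun i h₁ h₂ ↦ ?_⟩
      rcases hi i h₁ h₂ with h | h | h
      · exact Or.inl h
      · omega
      · exact Or.inr (Or.inr h)
    · refine Or.inr fun j hj ↦ ?_
      rw [Finset.mem_filter] at hj
      rcases hi j (by omega) (by omega) with h | h | ⟨j', hj', hjj⟩
      · have := Nat.add_le_of_dvd_of_dvd_of_lt h hp (by omega)
        omega
      · omega
      · exact (Fin.ext hjj : j' = j) ▸ hj'
  · rintro (h | h)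
    · refine h.mono (by omega) fun i ↦ Or.imp_right (Or.imp_left fun h ↦ by omega)
    · refine ⟨p + t - m, by omega, fun i h₁ h₂ ↦ ?_⟩
      rcases lt_trichotomy (i + 1) p with hip | hip | hip
      · exact Or.inr (Or.inr ⟨⟨i, by omega⟩, h (by simp; omega), rfl⟩)
      · exact Or.inl (by rwa [show i + 2 = p + 1 by omega])
      · exact Or.inr (Or.inl (by omega))

lemma splitsBelow_completesWindow_of_pred {c : ℕ} (hm : 1 ≤ m) (hp : m + 1 ∣ p + 1) (hmp : m ≤ p)
    (hpn : p ≤ n) (h : SplitsBelow c (CompletesWindow n m (p - 1) 0 0)) (t : ℕ) :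
    SplitsBelow (c + 1) (CompletesWindow n m (p + t) p t) := by
  by_cases ht : t + 1 < m
  · exact (h.or_subset _).congr fun F ↦ (completesWindow_iff hp hmp ht hpn F).symm
  · exact SplitsBelow.of_forall fun F ↦
      completesWindow_of_le hp (by omega) (by omega) F

lemma splitsBelow_completesWindow_add {c t r : ℕ} (hm : 1 ≤ m) (hp : m + 1 ∣ p + 1) (hmp : m ≤ p)
    (hr : t + r ≤ m) (hpn : p + (t + r) ≤ n)
    (h : SplitsBelow c (CompletesWindow n m (p - 1) 0 0)) :
    SplitsBelow (c + 2) (CompletesWindow n m (p + (t + r)) p t) := by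
  induction r generalizing t with
  | zero => exact (splitsBelow_completesWindow_of_pred hm hp hmp (by omega) h t).mono (by omega)
  | succ r ih =>
    have hx : p + t < n := by omega
    refine SplitsBelow.split _ ⟨p + t, hx⟩ monotone_completesWindow ?_ ?_
    · have := ih (t := t + 1) (by omega) (by omega)
      rw [show t + 1 + r = t + (r + 1) by omega] at this
      exact this.congr fun F ↦ (completesWindow_insert hx F).symm
    · exact ((splitsBelow_completesWindow_of_pred hm hp hmp (by omega) h t).or_mem _).congr
        fun F ↦ (completesWindow_or_mem hp hx (by omega) (by omega) F).symm

lemma completesWindow_zero (p : ℕ) :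
    CompletesWindow n m e p 0 = CompletesWindow n m e 0 0 := by
  funext F
  refine propext ⟨fun h ↦ h.mono le_rfl ?_, fun h ↦ h.mono le_rfl ?_⟩ <;>
    exact fun i ↦ Or.imp_right (Or.imp_left fun h ↦ by omega)

lemma splitsBelow_completesWindow (hm : 1 ≤ m) (k r : ℕ) (hr1 : 1 ≤ r) (hr : r ≤ m)
    (he : e + 1 = k * (m + 1) + r) (hen : e ≤ n) :
    SplitsBelow (2 * k) (CompletesWindow n m e 0 0) := by
  induction k generalizing e r with
  | zero =>
    refine (SplitsBelow.vars (∅ : Finset (Fin n)) (by simp)).congr fun F ↦ ?_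
    simp only [Finset.notMem_empty, false_and, exists_false, false_iff]
    rintro ⟨s, hs, -⟩
    omega
  | succ k ih =>
    have hk : (k + 1) * (m + 1) = k * (m + 1) + (m + 1) := by ring
    have h := splitsBelow_completesWindow_add (n := n) (t := 0) (r := r) (p := k * (m + 1) + m) hm
      ⟨k + 1, by ring⟩ (by omega) (by omega) (by omega) (ih m hm le_rfl (by omega) (by omega))
    rwa [completesWindow_zero, show k * (m + 1) + m + (0 + r) = e by omega] at h

lemma splitsBelow_completesWindow_self (hm : 1 ≤ m) (hmn : m ≤ n) :
    SplitsBelow ((n + 1) / (m + 1) + n / (m + 1)) (CompletesWindow n m n 0 0) := by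
  have hdm := Nat.div_add_mod (n + 1) (m + 1)
  have hlt := Nat.mod_lt (n + 1) (show 0 < m + 1 by omega)
  set k := (n + 1) / (m + 1)
  set r := (n + 1) % (m + 1)
  rw [mul_comm] at hdm
  by_cases hr : r = 0
  · obtain ⟨k', hk'⟩ : ∃ k', k = k' + 1 := Nat.exists_eq_succ_of_ne_zero fun h ↦ by
      rw [h] at hdm; omega
    have hk : (k' + 1) * (m + 1) = k' * (m + 1) + (m + 1) := by ring
    rw [hk'] at hdm
    have hn : n / (m + 1) = k' := by
      rw [Nat.div_eq_iff (by omega)]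
      omega
    have h := splitsBelow_completesWindow (n := n) (e := n - 1) hm k' m hm le_rfl
      (by omega) (by omega)
    have := splitsBelow_completesWindow_of_pred hm ⟨k' + 1, by rw [mul_comm]; omega⟩ hmn le_rfl h 0
    rw [completesWindow_zero] at this
    exact this.mono (by omega)
  · have hn : n / (m + 1) = k := by
      rw [Nat.div_eq_iff (by omega)]
      omega
    exact (splitsBelow_completesWindow (n := n) (e := n) hm k r (by omega) (by omega)
      (by omega) le_rfl).mono (by omega)

/-- The positions `≡ 0` (that start a window) and `≡ m` modulo `m + 1`. -/
def windowFacetCompl (n m : ℕ) : Finset (Fin n) :=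
  Finset.univ.filter fun j ↦ (j % (m + 1) = 0 ∧ j + m ≤ n) ∨ j % (m + 1) = m

lemma mem_windowFacetCompl {j : Fin n} : j ∈ windowFacetCompl n m ↔
    ((j : ℕ) % (m + 1) = 0 ∧ j + m ≤ n) ∨ (j : ℕ) % (m + 1) = m := by
  simp [windowFacetCompl]

lemma not_completesWindow_compl (hm : 3 ≤ m) :
    ¬ CompletesWindow n m n 0 0 (windowFacetCompl n m)ᶜ := by
  rintro ⟨s, hs, hi⟩
  have hdm := Nat.div_add_mod s (m + 1)
  have hlt := Nat.mod_lt s (show 0 < m + 1 by omega)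
  set b := s / (m + 1)
  set c := s % (m + 1)
  obtain ⟨a, ha, hsa, hca⟩ : ∃ a < m + 1, (s ≤ (m + 1) * b + a ∧ (m + 1) * b + a < s + m) ∧
      (a = 0 ∧ c = 0 ∨ a = m) := by
    by_cases hc : c = 0
    · exact ⟨0, by omega, by omega, by omega⟩
    · exact ⟨m, by omega, by omega, by omega⟩
  have hmod : ((m + 1) * b + a) % (m + 1) = a := Nat.mul_add_mod_of_lt_left _ b ha
  rcases hi _ hsa.1 hsa.2 with h | h | ⟨j, hj, hji⟩
  · rw [add_assoc, Nat.dvd_add_right (dvd_mul_right _ _)] at h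
    rcases hca with h' | h'
    · have := Nat.le_of_dvd (by omega) h
      omega
    · have := Nat.le_of_dvd (by omega) ((Nat.dvd_sub h (dvd_refl (m + 1))))
      omega
  · omega
  · rw [Finset.mem_compl, mem_windowFacetCompl, hji, hmod] at hj
    omega

lemma completesWindow_insert_compl {x : Fin n} (hx : x ∈ windowFacetCompl n m) :
    CompletesWindow n m n 0 0 (insert x (windowFacetCompl n m)ᶜ) := by
  have hdm := Nat.div_add_mod (x : ℕ) (m + 1)
  set b := (x : ℕ) / (m + 1)
  have key : ∀ a (hn : (m + 1) * b + a < n), 1 ≤ a → a < m →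
      (⟨(m + 1) * b + a, hn⟩ : Fin n) ∈ insert x (windowFacetCompl n m)ᶜ := by
    intro a hn ha1 ha
    refine Finset.mem_insert_of_mem (Finset.mem_compl.2 fun hc ↦ ?_)
    simp only [mem_windowFacetCompl] at hc
    rw [Nat.mul_add_mod_of_lt_left _ b (show a < m + 1 by omega)] at hc
    omega
  rw [mem_windowFacetCompl] at hx
  obtain ⟨s, hs, hsx⟩ : ∃ s, s + m ≤ n ∧ ∀ i, s ≤ i → i < s + m →
      i = x ∨ ∃ a, i = (m + 1) * b + a ∧ 1 ≤ a ∧ a < m := by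
    rcases hx with hx | hx
    · refine ⟨x, hx.2, fun i h₁ h₂ ↦ or_iff_not_imp_left.2 fun hne ↦
        ⟨i - (m + 1) * b, by omega, by omega, by omega⟩⟩
    · refine ⟨(m + 1) * b + 1, by omega, fun i h₁ h₂ ↦ or_iff_not_imp_left.2 fun hne ↦
        ⟨i - (m + 1) * b, by omega, by omega, by omega⟩⟩
  refine ⟨s, hs, fun i h₁ h₂ ↦ Or.inr (Or.inr ?_)⟩
  rcases hsx i h₁ h₂ with rfl | ⟨a, rfl, ha⟩
  · exact ⟨x, Finset.mem_insert_self _ _, rfl⟩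
  · exact ⟨_, key a (by omega) ha.1 ha.2, rfl⟩

lemma le_card_windowFacetCompl (hm : 1 ≤ m) :
    (n + 1) / (m + 1) + n / (m + 1) ≤ (windowFacetCompl n m).card := by
  have hinj : ∀ a, Function.Injective fun b ↦ (m + 1) * b + a := fun a b c h ↦ by
    simpa using h
  have hdisj : Disjoint ((Finset.range ((n + 1) / (m + 1))).image fun b ↦ (m + 1) * b + 0)
      ((Finset.range (n / (m + 1))).image fun b ↦ (m + 1) * b + m) := by
    rw [Finset.disjoint_left]
    simp only [Finset.mem_image]
    rintro _ ⟨b, -, rfl⟩ ⟨c, -, h⟩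
    have h₁ := Nat.mul_add_mod_of_lt_left (m + 1) c (show m < m + 1 by omega)
    rw [h, Nat.mul_add_mod_of_lt_left _ _ (by omega)] at h₁
    omega
  have hle : ∀ b N, b < N / (m + 1) → (m + 1) * b + m + 1 ≤ N := fun b N hb ↦ by
    have h₁ := Nat.mul_le_mul_left (m + 1) (Nat.succ_le_of_lt hb)
    have h₂ := Nat.mul_div_le N (m + 1)
    rw [Nat.mul_succ] at h₁
    omega
  rw [← Finset.card_map Fin.valEmbedding]
  calc _ = _ := by
        rw [Finset.card_union_of_disjoint hdisj, Finset.card_image_of_injective _ (hinj 0),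
          Finset.card_image_of_injective _ (hinj m), Finset.card_range, Finset.card_range]
    _ ≤ _ := Finset.card_le_card (Finset.union_subset ?_ ?_)
  · intro i hi
    obtain ⟨b, hb, rfl⟩ := Finset.mem_image.1 hi
    have hb' := hle b _ (Finset.mem_range.1 hb)
    exact Finset.mem_map.2 ⟨⟨(m + 1) * b + 0, by omega⟩, mem_windowFacetCompl.2
      (Or.inl ⟨Nat.mul_add_mod_of_lt_left _ b (by omega), by simp only; omega⟩), rfl⟩
  · intro i hi
    obtain ⟨b, hb, rfl⟩ := Finset.mem_image.1 hi
    have hb' := hle b _ (Finset.mem_range.1 hb)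
    exact Finset.mem_map.2 ⟨⟨(m + 1) * b + m, by omega⟩, mem_windowFacetCompl.2
      (Or.inr (Nat.mul_add_mod_of_lt_left _ b (by omega))), rfl⟩

end Window

section PathIdeal

variable {K : Type} [Field K] {n m : ℕ}

lemma monotone_hasWindow_mem : Monotone fun F : Finset (Fin n) ↦
    HasWindow m n fun i ↦ ∃ j ∈ F, (j : ℕ) = i :=
  fun _ _ h H ↦ H.mono le_rfl fun _ ⟨j, hj, hji⟩ ↦ ⟨j, h hj, hji⟩

lemma pathIdeal_eq_supportIdeal (hmn : m ≤ n) : pathIdeal K n m =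
    supportIdeal K fun F : Finset (Fin n) ↦
      HasWindow m n fun i ↦ ∃ j ∈ F, (j : ℕ) = i := by
  refine le_antisymm (Ideal.span_le.2 ?_) (Ideal.span_le.2 ?_)
  · rintro _ ⟨i, hi1, hi, rfl⟩
    refine prod_X_mem_supportIdeal monotone_hasWindow_mem ⟨i - 1, by omega, fun l h₁ h₂ ↦
      ⟨⟨l, by omega⟩, ?_, rfl⟩⟩
    simp only [Finset.mem_filter, Finset.mem_univ, true_and]
    omega
  · rintro _ ⟨s, ⟨a, ha, h⟩, rfl⟩
    refine Ideal.mem_of_dvd _ (prod_X_dvd_monomial fun j hj ↦ ?_)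
      (Ideal.subset_span ⟨a + 1, by omega, by omega, rfl⟩)
    rw [Finset.mem_filter] at hj
    obtain ⟨j', hj', hjj⟩ := h j (by omega) (by omega)
    exact (Fin.ext hjj : j' = j) ▸ hj'

lemma prod_xv_eq (hm : 1 ≤ m) :
    ∏ l ∈ Finset.Icc 1 ((n + 1) / (m + 1)), xv K n (l * (m + 1) - 1) =
      ∏ j ∈ Finset.univ.filter (fun j : Fin n ↦ m + 1 ∣ j + 2), X j := by
  symm
  have hdiv : ∀ j : Fin n, m + 1 ∣ (j : ℕ) + 2 → (j + 2) / (m + 1) * (m + 1) = j + 2 :=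
    fun j hj ↦ Nat.div_mul_cancel hj
  refine Finset.prod_bij (fun j _ ↦ ((j : ℕ) + 2) / (m + 1)) (fun j hj ↦ ?_) (fun j hj i hi h ↦ ?_)
    (fun l hl ↦ ?_) (fun j hj ↦ ?_)
  · exact Finset.mem_Icc.2 ⟨Nat.div_pos (Nat.le_of_dvd (by omega) (Finset.mem_filter.1 hj).2)
      (by omega), Nat.div_le_div_right (by omega)⟩
  · have h₁ := hdiv j (Finset.mem_filter.1 hj).2
    rw [h, hdiv i (Finset.mem_filter.1 hi).2] at h₁
    exact Fin.ext (by omega)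
  · rw [Finset.mem_Icc] at hl
    have h₁ := Nat.mul_le_mul_right (m + 1) hl.1
    have h₂ := (Nat.mul_le_mul_right (m + 1) hl.2).trans (Nat.div_mul_le_self (n + 1) (m + 1))
    have h₃ : l * (m + 1) - 2 + 2 = l * (m + 1) := by omega
    refine ⟨⟨l * (m + 1) - 2, by omega⟩, ?_, ?_⟩
    · simp [h₃]
    · simp only [h₃]
      exact Nat.mul_div_cancel _ (by omega)
  · simp only [hdiv j (Finset.mem_filter.1 hj).2]
    rw [xv, dif_pos (by omega)]
    rfl

lemma colon_pathIdeal_eq (hm : 1 ≤ m) (hmn : m ≤ n) :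
    (pathIdeal K n m).colon
        (Ideal.span {∏ l ∈ Finset.Icc 1 ((n + 1) / (m + 1)), xv K n (l * (m + 1) - 1)}) =
      supportIdeal K (CompletesWindow n m n 0 0) := by
  ext f
  rw [Ideal.mem_colon_span_singleton, prod_xv_eq hm, pathIdeal_eq_supportIdeal hmn, mul_comm,
    prod_X_mul_mem_supportIdeal_iff monotone_hasWindow_mem]
  have : (fun F ↦ HasWindow m n fun i ↦ ∃ j ∈ Finset.univ.filter
      (fun j : Fin n ↦ m + 1 ∣ j + 2) ∪ F, (j : ℕ) = i) = CompletesWindow n m n 0 0 := by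
    funext F
    refine propext (exists_congr fun s ↦ and_congr_right fun hs ↦ forall₃_congr fun i _ _ ↦ ?_)
    constructor
    · rintro ⟨j, hj, rfl⟩
      exact (Finset.mem_union.1 hj).imp (by simp) fun h ↦ Or.inr ⟨j, h, rfl⟩
    · rintro (h | h | ⟨j, hj, hji⟩)
      · exact ⟨⟨i, by omega⟩, Finset.mem_union_left _ (by simpa using h), rfl⟩
      · omega
      · exact ⟨j, Finset.mem_union_right _ hj, hji⟩
  rw [this]

end PathIdeal

section

variable {σ K : Type*} [Field K]

lemma one_notMem_idealOfVars : (1 : MvPolynomial σ K) ∉ idealOfVars σ K := by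
  intro h
  have hle : idealOfVars σ K ≤ RingHom.ker (constantCoeff (σ := σ) (R := K)) := by
    refine Ideal.span_le.2 ?_
    rintro _ ⟨x, rfl⟩
    simp
  simpa using hle h

lemma isRegular_quotient_of_le_idealOfVars {J : Ideal (MvPolynomial σ K)}
    (hJ : J ≤ idealOfVars σ K) {rs : List (MvPolynomial σ K)}
    (hrs : ∀ r ∈ rs, r ∈ idealOfVars σ K) (h : J.WeaklyRegularMod rs) :
    RingTheory.Sequence.IsRegular (MvPolynomial σ K ⧸ J) rs := by
  refine ⟨(Ideal.isWeaklyRegular_quotient_iff J rs).2 h, fun hc ↦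
    one_notMem_idealOfVars (σ := σ) (K := K) ?_⟩
  have h1 : (Submodule.mkQ J) 1 ∈ Ideal.ofList rs • (⊤ : Submodule _ (MvPolynomial σ K ⧸ J)) :=
    hc.le trivial
  rw [← Submodule.range_mkQ J, ← Submodule.map_top, ← Submodule.map_smul''] at h1
  obtain ⟨y, hy, hy1⟩ := h1
  have hy' : y ∈ Ideal.ofList rs := by
    simpa using hy
  have hJ1 : y - 1 ∈ J := (Submodule.Quotient.eq J).1 hy1
  have : y ∈ idealOfVars σ K := Ideal.span_le.2 hrs hy'
  simpa using Ideal.sub_mem _ this (hJ hJ1)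

end

/-- For `m ≥ 3`, `n ≥ 2m` and `k = ⌊(n+1)/(m+1)⌋`: with
`L_k = (I_{n,m} : x_m x_{2m+1} ⋯ x_{k(m+1)-1})`, one has
`depth(S/L_k) = n + 1 − ⌊(n+1)/(m+1)⌋ − ⌈(n+1)/(m+1)⌉`. -/
theorem stmt_15 (K : Type) [Field K] (n m : ℕ) (hm : 3 ≤ m) (hn : 2 * m ≤ n)
    (k : ℕ) (hk : k = (n + 1) / (m + 1))
    (L : Ideal (MvPolynomial (Fin n) K))
    (hL : L = (pathIdeal K n m).colon
        (Ideal.span {∏ l ∈ Finset.Icc 1 k, xv K n (l * (m + 1) - 1)})) :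
    IsGreatest (homogRegSeqLengths K n L)
      (n + 1 - (n + 1) / (m + 1) - (n + m + 1) / (m + 1)) := by
  subst hk hL
  rw [colon_pathIdeal_eq (by omega) (by omega)]
  have hmn : m ≤ n := by omega
  have hceil : (n + m + 1) / (m + 1) = n / (m + 1) + 1 := by
    rw [add_assoc, Nat.add_div_right _ (by omega)]
  have hcard := le_card_windowFacetCompl (n := n) (show 1 ≤ m by omega)
  have hbound := (windowFacetCompl n m).card_le_univ
  rw [Fintype.card_fin] at hbound
  constructor
  · refine ⟨esymmList (Fin n) K _, length_esymmList _, esymmList_homogeneous,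
      isRegular_quotient_of_le_idealOfVars (supportIdeal_le_idealOfVars fun h ↦ ?_)
        (fun r hr ↦ (esymmList_homogeneous r hr).2)
        ((splitsBelow_completesWindow_self (by omega) hmn).weaklyRegularMod_esymmList ?_)⟩
    · exact not_completesWindow_compl hm (monotone_completesWindow (Finset.empty_subset _) h)
    · rw [Fintype.card_fin]
      omega
  · rintro _ ⟨rs, rfl, hrs, hreg⟩
    have := length_le_card_compl_of_weaklyRegularMod monotone_completesWindow
      (windowFacetCompl n m) (not_completesWindow_compl hm)
      (fun x hx ↦ completesWindow_insert_compl hx) hrs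
      ((Ideal.isWeaklyRegular_quotient_iff _ _).1 hreg.1)
    rw [Fintype.card_fin] at this
    omega
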